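/- arXiv:1610.01931 — 3 statements merged into one kernel-verified Lean document; each statement's English description precedes it below -/
import Mathlib

section
/- Fix $N \geq 2$, angles $\alpha_1, \dots, \alpha_N \in [0, 2\pi)$ and $\phi_1, \dots, \phi_{N-1} \in [0, \pi/2]$. Define the vectors $R_{N,k} = (r_{1,k}, \dots, r_{N,k})^T \in \mathbb{C}^N$ for $k = 1, \dots, N$ by: $r_{j,N} = e^{i\alpha_j} \sin\phi_j \prod_{l=1}^{j-1} \cos\phi_l$ for $j < N$ and $r_{N,N} = e^{i\alpha_N} \prod_{l=1}^{N-1} \cos\phi_l$; for $k < N-1$: $r_{j,k} = 0$ if $j < k$, $r_{k,k} = e^{i\alpha_k} \cos\phi_k$, $r_{j,k} = -e^{i\alpha_j} \sin\phi_k \sin\phi_j \prod_{l=k+1}^{j-1} \cos\phi_l$ for $k < j \leq N-1$, and $r_{N,k} = -e^{i\alpha_N} \sin\phi_k \prod_{l=k+1}^{N-1} \cos\phi_l$; and $r_{j,N-1} = 0$ for $j < N-1$, $r_{N-1,N-1} = e^{-i\neg_{N-1}} \cos\phi_{N-1}$, $r_{N,N-1} = -e^{-i\neg_N} \sin\phi_{N-1}$,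 where $\neg_j = \sum_{k=1}^{j-1} \alpha_k + \sum_{k=j+1}^{N} \alpha_k$. Then the vectors $R_{N,1}, \dots, R_{N,N}$ are orthonormal with respect to the standard Hermitian inner product on $\mathbb{C}^N$. -/
open Complex Finset

/-- `¬_j = ∑_{k=1}^{j-1} α_k + ∑_{k=j+1}^{N} α_k` (indices are 1-based). -/
noncomputable def negSum (N : ℕ) (α : ℕ → ℝ) (j : ℕ) : ℝ :=
  (∑ l ∈ Finset.Icc 1 (j - 1), α l) + ∑ l ∈ Finset.Icc (j + 1) N, α l

/-- The entry `r_{j,k}` (1-based indices `j, k ∈ {1, …, N}`) of the matrix `R_N` built from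
the angles `α_1, …, α_N` and `φ_1, …, φ_{N-1}`, as in equations (2.2)–(2.4):
column `N` is the spherical parametrization of the unit sphere of `ℂ^N`, columns `k < N - 1`
and column `N - 1` are given by the stated case distinctions. -/
noncomputable def rEntry (N : ℕ) (α φ : ℕ → ℝ) (j k : ℕ) : ℂ :=
  if k = N then
    if j < N then
      Complex.exp (Complex.I * (α j : ℂ)) * (Real.sin (φ j) : ℂ) *
        ∏ l ∈ Finset.Icc 1 (j - 1), (Real.cos (φ l) : ℂ)
    else
      Complex.exp (Complex.I * (α N : ℂ)) * ∏ l ∈ Finset.Icc 1 (N - 1), (Real.cos (φ l) : ℂ)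
  else if k = N - 1 then
    if j < N - 1 then 0
    else if j = N - 1 then
      Complex.exp (-Complex.I * (negSum N α (N - 1) : ℂ)) * (Real.cos (φ (N - 1)) : ℂ)
    else
      -(Complex.exp (-Complex.I * (negSum N α N : ℂ)) * (Real.sin (φ (N - 1)) : ℂ))
  else
    if j < k then 0
    else if j = k then Complex.exp (Complex.I * (α k : ℂ)) * (Real.cos (φ k) : ℂ)
    else if j ≤ N - 1 then
      -(Complex.exp (Complex.I * (α j : ℂ)) * (Real.sin (φ k) : ℂ) * (Real.sin (φ j) : ℂ) *
        ∏ l ∈ Finset.Icc (k + 1) (j - 1), (Real.cos (φ l) : ℂ))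
    else
      -(Complex.exp (Complex.I * (α N : ℂ)) * (Real.sin (φ k) : ℂ) *
        ∏ l ∈ Finset.Icc (k + 1) (N - 1), (Real.cos (φ l) : ℂ))

/-- Entry `j` of the real column obtained from sequences of sines `s` and cosines `c`,
with pivot at position `k`. -/
noncomputable def pivotColumn (s c : ℕ → ℝ) (k j : ℕ) : ℝ :=
  if j < k then 0 else if j = k then c k else -(s k * s j * ∏ l ∈ Finset.Ico (k + 1) j, c l)

theorem sum_sq_mul_prod_sq_add_prod_sq {s c : ℕ → ℝ} (h : ∀ l, s l ^ 2 + c l ^ 2 = 1)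
    {a b : ℕ} (hab : a ≤ b) :
    ∑ j ∈ Finset.Ico a b, s j ^ 2 * (∏ l ∈ Finset.Ico a j, c l) ^ 2 +
      (∏ l ∈ Finset.Ico a b, c l) ^ 2 = 1 := by
  induction b, hab using Nat.le_induction with
  | base => simp
  | succ b hab ih =>
    rw [Finset.sum_Ico_succ_top hab, Finset.prod_Ico_succ_top hab]
    linear_combination ih + (∏ l ∈ Finset.Ico a b, c l) ^ 2 * h b

theorem sum_sq_mul_prod_sq_eq_one {s c : ℕ → ℝ} (h : ∀ l, s l ^ 2 + c l ^ 2 = 1)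
    {m N : ℕ} (hm : m < N) (hN : c N = 0) :
    ∑ j ∈ Finset.Ico (m + 1) (N + 1), s j ^ 2 * (∏ l ∈ Finset.Ico (m + 1) j, c l) ^ 2 = 1 := by
  have := sum_sq_mul_prod_sq_add_prod_sq h (a := m + 1) (b := N + 1) (by omega)
  rw [Finset.prod_Ico_succ_top (by omega : m + 1 ≤ N), hN] at this
  simpa using this

theorem sum_pivotColumn_mul_self {s c : ℕ → ℝ} (h : ∀ l, s l ^ 2 + c l ^ 2 = 1)
    {m N : ℕ} (hm : m < N) (hN : c N = 0) :
    ∑ j ∈ Finset.range (N + 1), pivotColumn s c m j * pivotColumn s c m j = 1 := by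
  rw [← Finset.sum_range_add_sum_Ico _ (by omega : m ≤ N + 1),
    Finset.sum_eq_zero, Finset.sum_eq_sum_Ico_succ_bot (by omega : m < N + 1)]
  · have : ∑ j ∈ Finset.Ico (m + 1) (N + 1), pivotColumn s c m j * pivotColumn s c m j =
        s m ^ 2 * ∑ j ∈ Finset.Ico (m + 1) (N + 1),
          s j ^ 2 * (∏ l ∈ Finset.Ico (m + 1) j, c l) ^ 2 := by
      rw [Finset.mul_sum]
      refine Finset.sum_congr rfl fun j hj => ?_
      rw [Finset.mem_Ico] at hj
      rw [pivotColumn, if_neg (by omega), if_neg (by omega)]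
      ring
    rw [this, sum_sq_mul_prod_sq_eq_one h hm hN]
    simp only [pivotColumn, lt_irrefl, if_false, if_true]
    linear_combination h m
  · intro j hj
    simp [pivotColumn, Finset.mem_range.1 hj]

theorem sum_pivotColumn_mul_of_lt {s c : ℕ → ℝ} (h : ∀ l, s l ^ 2 + c l ^ 2 = 1)
    {k m N : ℕ} (hkm : k < m) (hm : m < N) (hN : c N = 0) :
    ∑ j ∈ Finset.range (N + 1), pivotColumn s c k j * pivotColumn s c m j = 0 := by
  rw [← Finset.sum_range_add_sum_Ico _ (by omega : m ≤ N + 1),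
    Finset.sum_eq_zero, Finset.sum_eq_sum_Ico_succ_bot (by omega : m < N + 1)]
  · have : ∑ j ∈ Finset.Ico (m + 1) (N + 1), pivotColumn s c k j * pivotColumn s c m j =
        s k * s m * (∏ l ∈ Finset.Ico (k + 1) m, c l) * c m *
          ∑ j ∈ Finset.Ico (m + 1) (N + 1),
            s j ^ 2 * (∏ l ∈ Finset.Ico (m + 1) j, c l) ^ 2 := by
      rw [Finset.mul_sum]
      refine Finset.sum_congr rfl fun j hj => ?_
      rw [Finset.mem_Ico] at hj
      rw [pivotColumn, if_neg (by omega), if_neg (by omega), pivotColumn, if_neg (by omega),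
        if_neg (by omega), ← Finset.prod_Ico_consecutive c (by omega : k + 1 ≤ m)
        (by omega : m ≤ j), Finset.prod_eq_prod_Ico_succ_bot (by omega : m < j)]
      ring
    rw [this, sum_sq_mul_prod_sq_eq_one h hm hN, pivotColumn, if_neg (by omega),
      if_neg (by omega), pivotColumn, if_neg (by omega), if_pos rfl]
    ring
  · intro j hj
    simp [pivotColumn, Finset.mem_range.1 hj]

theorem sum_pivotColumn_mul {s c : ℕ → ℝ} (h : ∀ l, s l ^ 2 + c l ^ 2 = 1)
    {k m N : ℕ} (hk : k < N) (hm : m < N) (hN : c N = 0) :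
    ∑ j ∈ Finset.range (N + 1), pivotColumn s c k j * pivotColumn s c m j =
      if k = m then 1 else 0 := by
  rcases lt_trichotomy k m with hkm | rfl | hkm
  · rw [if_neg hkm.ne, sum_pivotColumn_mul_of_lt h hkm hm hN]
  · rw [if_pos rfl, sum_pivotColumn_mul_self h hm hN]
  · rw [if_neg hkm.ne', ← sum_pivotColumn_mul_of_lt h hkm hk hN]
    exact Finset.sum_congr rfl fun j _ => mul_comm _ _

/-- The sines of the angles `φ`, extended by the boundary values `-1` at `0` and `1` at `N`. -/
noncomputable def boundarySin (N : ℕ) (φ : ℕ → ℝ) (l : ℕ) : ℝ :=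
  if l = 0 then -1 else if l = N then 1 else Real.sin (φ l)

/-- The cosines of the angles `φ`, extended by the boundary value `0` at `0` and `N`. -/
noncomputable def boundaryCos (N : ℕ) (φ : ℕ → ℝ) (l : ℕ) : ℝ :=
  if l = 0 then 0 else if l = N then 0 else Real.cos (φ l)

theorem boundarySin_sq_add_boundaryCos_sq (N : ℕ) (φ : ℕ → ℝ) (l : ℕ) :
    boundarySin N φ l ^ 2 + boundaryCos N φ l ^ 2 = 1 := by
  unfold boundarySin boundaryCos
  split_ifs <;> simp

theorem prod_boundaryCos {N : ℕ} (φ : ℕ → ℝ) (k : ℕ) {j : ℕ} (h1 : 1 ≤ j) (hj : j ≤ N) :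
    ∏ l ∈ Finset.Ico (k + 1) j, boundaryCos N φ l =
      ∏ l ∈ Finset.Icc (k + 1) (j - 1), Real.cos (φ l) := by
  refine Finset.prod_congr ?_ fun l hl => ?_
  · ext l
    simp only [Finset.mem_Ico, Finset.mem_Icc]
    omega
  · rw [Finset.mem_Icc] at hl
    rw [boundaryCos, if_neg (by omega), if_neg (by omega)]

theorem negSum_add {N : ℕ} (α : ℕ → ℝ) {j : ℕ} (h1 : 1 ≤ j) (hj : j ≤ N) :
    negSum N α j + α j = ∑ l ∈ Finset.Icc 1 N, α l := by
  have hN : Finset.Icc 1 N = Finset.Ico 1 (N + 1) := by ext; simp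
  have hl : Finset.Icc 1 (j - 1) = Finset.Ico 1 j := by ext; simp; omega
  have hr : Finset.Icc (j + 1) N = Finset.Ico (j + 1) (N + 1) := by ext; simp
  rw [negSum, hN, hl, hr, ← Finset.sum_Ico_consecutive α h1 (by omega : j ≤ N + 1),
    Finset.sum_eq_sum_Ico_succ_bot (by omega : j < N + 1)]
  ring

theorem exp_neg_negSum {N : ℕ} (α : ℕ → ℝ) {j : ℕ} (h1 : 1 ≤ j) (hj : j ≤ N) :
    Complex.exp (-Complex.I * (negSum N α j : ℂ)) =
      Complex.exp (((-∑ l ∈ Finset.Icc 1 N, α l : ℝ) : ℂ) * Complex.I) *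
        Complex.exp (Complex.I * (α j : ℂ)) := by
  rw [← Complex.exp_add, ← negSum_add α h1 hj]
  congr 1
  push_cast
  ring

theorem rEntry_eq {N : ℕ} (α φ : ℕ → ℝ) {j k : ℕ} (hj : 1 ≤ j) (hjN : j ≤ N)
    (hk : 1 ≤ k) (hkN : k ≤ N) :
    rEntry N α φ j k =
      Complex.exp (((if k + 1 = N then -∑ l ∈ Finset.Icc 1 N, α l else 0 : ℝ) : ℂ) * Complex.I) *
        Complex.exp (Complex.I * (α j : ℂ)) *
        (pivotColumn (boundarySin N φ) (boundaryCos N φ) (if k = N then 0 else k) j : ℂ) := by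
  have hj0 : j ≠ 0 := by omega
  have hk0 : k ≠ 0 := by omega
  unfold rEntry pivotColumn
  rw [prod_boundaryCos φ _ hj hjN]
  by_cases hkN' : k = N
  · subst hkN'
    rcases hjN.lt_or_eq with h | rfl
    · simp [boundarySin, hj0, h, h.ne]
      ring
    · simp [boundarySin, hj0]
  · by_cases hk1 : k + 1 = N
    · obtain rfl := hk1
      rcases lt_trichotomy j k with h | rfl | h
      · simp [h]
      · rw [if_neg (by omega), if_pos (by omega), if_neg (by omega), if_pos (by omega)]
        simp only [Nat.add_sub_cancel]
        rw [exp_neg_negSum α hj hjN]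
        simp [boundaryCos, hj0]
      · obtain rfl : j = k + 1 := by omega
        rw [exp_neg_negSum α hj hjN]
        simp [boundarySin, hk0]
    · have hk1' : k ≠ N - 1 := by omega
      rcases lt_trichotomy j k with h | rfl | h
      · simp [h, hkN', hk1']
      · simp [hkN', hk1, hk1', boundaryCos, hj0]
      · have h1 : ¬ j < k := by omega
        have h2 : j ≠ k := by omega
        rcases hjN.lt_or_eq with h3 | rfl
        · have h4 : j ≤ N - 1 := by omega
          simp [h1, h2, h4, h3.ne, hkN', hk1, hk1', boundarySin, hj0, hk0]
          ring
        · have h4 : ¬ j ≤ j - 1 := by omega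
          simp [h1, h2, h4, hkN', hk1, hk1', boundarySin, hj0, hk0]
          ring

theorem conj_exp_mul_exp (x : ℝ) :
    (starRingEnd ℂ) (Complex.exp (x * Complex.I)) * Complex.exp (x * Complex.I) = 1 := by
  rw [← Complex.normSq_eq_conj_mul_self, Complex.normSq_eq_norm_sq,
    Complex.norm_exp_ofReal_mul_I]
  simp

/-- For `N ≥ 2`, angles `α_1, …, α_N ∈ [0, 2π)` and
`φ_1, …, φ_{N-1} ∈ [0, π/2]`, the columns `R_{N,1}, …, R_{N,N}` are orthonormal with respect
to the standard Hermitian inner product on `ℂ^N`. -/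
theorem rEntry_columns_orthonormal (N : ℕ) (hN : 2 ≤ N) (α φ : ℕ → ℝ)
    (hα : ∀ j ∈ Finset.Icc 1 N, α j ∈ Set.Ico 0 (2 * Real.pi))
    (hφ : ∀ j ∈ Finset.Icc 1 (N - 1), φ j ∈ Set.Icc 0 (Real.pi / 2)) :
    Orthonormal ℂ (fun k : Fin N =>
      (WithLp.equiv 2 (Fin N → ℂ)).symm
        (fun j : Fin N => rEntry N α φ ((j : ℕ) + 1) ((k : ℕ) + 1))) := by
  rw [orthonormal_iff_ite]
  intro k m
  have hk := k.isLt
  have hm := m.isLt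
  simp only [WithLp.equiv_symm_apply, PiLp.inner_apply, RCLike.inner_apply]
  have key := sum_pivotColumn_mul (boundarySin_sq_add_boundaryCos_sq N φ)
    (k := if (k : ℕ) + 1 = N then 0 else (k : ℕ) + 1)
    (m := if (m : ℕ) + 1 = N then 0 else (m : ℕ) + 1) (N := N)
    (by split_ifs <;> omega) (by split_ifs <;> omega) (by simp [boundaryCos])
  rw [Finset.sum_range_succ', ← Fin.sum_univ_eq_sum_range (fun j =>
    pivotColumn (boundarySin N φ) (boundaryCos N φ) _ (j + 1) *
      pivotColumn (boundarySin N φ) (boundaryCos N φ) _ (j + 1))] at key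
  have hzero : ∀ p, pivotColumn (boundarySin N φ) (boundaryCos N φ) p 0 = 0 := by
    intro p
    rcases Nat.eq_zero_or_pos p with rfl | hp
    · simp [pivotColumn, boundaryCos]
    · simp [pivotColumn, hp]
  rw [hzero, zero_mul, add_zero] at key
  have hidx : ((if (k : ℕ) + 1 = N then 0 else (k : ℕ) + 1) =
      if (m : ℕ) + 1 = N then 0 else (m : ℕ) + 1) ↔ k = m := by
    rw [Fin.ext_iff]
    split_ifs <;> simp <;> omega
  simp only [hidx] at key
  set w : Fin N → ℂ := fun k => Complex.exp
    (((if (k : ℕ) + 1 + 1 = N then -∑ l ∈ Finset.Icc 1 N, α l else 0 : ℝ) : ℂ) * Complex.I)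
    with hw
  calc _ = (starRingEnd ℂ) (w k) * w m * ((∑ j : Fin N,
        pivotColumn (boundarySin N φ) (boundaryCos N φ)
          (if (k : ℕ) + 1 = N then 0 else (k : ℕ) + 1) (j + 1) *
        pivotColumn (boundarySin N φ) (boundaryCos N φ)
          (if (m : ℕ) + 1 = N then 0 else (m : ℕ) + 1) (j + 1) : ℝ) : ℂ) := by
        rw [Complex.ofReal_sum, Finset.mul_sum]
        refine Finset.sum_congr rfl fun j _ => ?_
        rw [rEntry_eq α φ (by omega) (by omega) (by omega) (by omega),
          rEntry_eq α φ (by omega) (by omega) (by omega) (by omega)]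
        have hα' := conj_exp_mul_exp (α (j + 1))
        rw [mul_comm _ Complex.I] at hα'
        simp only [map_mul, Complex.conj_ofReal, Complex.ofReal_mul, hw]
        linear_combination (starRingEnd ℂ (w k) * w m *
          (pivotColumn (boundarySin N φ) (boundaryCos N φ)
            (if (k : ℕ) + 1 = N then 0 else (k : ℕ) + 1) (j + 1) : ℂ) *
          (pivotColumn (boundarySin N φ) (boundaryCos N φ)
            (if (m : ℕ) + 1 = N then 0 else (m : ℕ) + 1) (j + 1) : ℂ)) * hα'
    _ = _ := by
        rw [key]
        by_cases hkm : k = m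
        · subst hkm
          simp only [if_true, hw, conj_exp_mul_exp, Complex.ofReal_one, mul_one]
        · simp [hkm]
end

section
/- Fix $N \geq 2$, angles $\alpha_1, \dots, \alpha_N \in [0, 2\pi)$ and $\phi_1, \dots, \phi_{N-1} \in [0, \pi/2]$, and let $R_{N,1}, \dots, R_{N,N} \in \mathbb{C}^N$ be the vectors defined as follows: $r_{j,N} = e^{i\alpha_j} \sin\phi_j \prod_{l=1}^{j-1} \cos\phi_l$ for $j < N$ and $r_{N,N} = e^{i\alpha_N} \prod_{l=1}^{N-1} \cos\phi_l$; for $k < N-1$: $r_{j,k} = 0$ if $j < k$, $r_{k,k} = e^{i\alpha_k} \cos\phi_k$, $r_{j,k} = -e^{i\alpha_j} \sin\phi_k \sin\phi_j \prod_{l=k+1}^{j-1} \cos\phi_l$ for $k < j \leq N-1$, and $r_{N,k} = -e^{i\alpha_N} \sin\phi_k \prod_{l=k+1}^{N-1} \cos\phi_l$; and $r_{j,N-1} = 0$ for $j < N-1$, $r_{N-1,N-1} = e^{-i\neg_{N-1}} \cos\phi_{N-1}$, $r_{N,N-1} = -e^{-i\neg_N} \sin\phi_{N-1}$, where $\neg_j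 = \sum_{k=1}^{j-1} \alpha_k + \sum_{k=j+1}^{N} \alpha_k$. Then there exists $s \in \{0,1\}$ such that the matrix $R_N$ with columns $(-1)^s R_{N,1}, R_{N,2}, \dots, R_{N,N}$ belongs to $SU(N)$; equivalently, the determinant of the matrix with columns $R_{N,1}, \dots, R_{N,N}$ is $1$ or $-1$. -/
open Complex Finset Matrix

/-- The unit vector `∑_{j > k} (sin φ_j ∏_{k < l < j} cos φ_l) e_j`, where the factor `sin φ_N` is
replaced by `1`. -/
noncomputable def tailVec (N : ℕ) (φ : ℕ → ℝ) (k j : ℕ) : ℝ :=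
  if j ≤ k then 0
  else (if j < N then Real.sin (φ j) else 1) * ∏ l ∈ Finset.Icc (k + 1) (j - 1), Real.cos (φ l)

/-- The column `cos φ_k e_k - sin φ_k tailVec_k`, and `tailVec_0` for `k = N`. -/
noncomputable def realCol (N : ℕ) (φ : ℕ → ℝ) (k j : ℕ) : ℝ :=
  if k = N then tailVec N φ 0 j
  else (if j = k then Real.cos (φ k) else 0) - Real.sin (φ k) * tailVec N φ k j

theorem tailVec_of_le {N : ℕ} {φ : ℕ → ℝ} {k j : ℕ} (h : j ≤ k) : tailVec N φ k j = 0 :=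
  if_pos h

theorem tailVec_eq_prod_mul {N : ℕ} {φ : ℕ → ℝ} {m k j : ℕ} (hmk : m ≤ k) (hkj : k < j) :
    tailVec N φ m j = (∏ l ∈ Finset.Icc (m + 1) k, Real.cos (φ l)) * tailVec N φ k j := by
  have hprod : ∏ l ∈ Finset.Icc (m + 1) (j - 1), Real.cos (φ l) =
      (∏ l ∈ Finset.Icc (m + 1) k, Real.cos (φ l)) *
        ∏ l ∈ Finset.Icc (k + 1) (j - 1), Real.cos (φ l) := by
    rw [← Finset.prod_union]
    · congr 1
      ext x
      simp only [Finset.mem_union, Finset.mem_Icc]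
      omega
    · rw [Finset.disjoint_left]
      intro x
      simp only [Finset.mem_Icc]
      omega
  rw [tailVec, tailVec, if_neg (by omega : ¬ j ≤ m), if_neg (by omega : ¬ j ≤ k), hprod]
  ring

theorem tailVec_eq_single_add {N : ℕ} {φ : ℕ → ℝ} {k : ℕ} (hk : k + 1 < N) (j : ℕ) :
    tailVec N φ k j =
      (if j = k + 1 then Real.sin (φ (k + 1)) else 0) +
        Real.cos (φ (k + 1)) * tailVec N φ (k + 1) j := by
  rcases lt_trichotomy j (k + 1) with h | rfl | h
  · rw [tailVec_of_le (by omega), tailVec_of_le (by omega), if_neg (by omega)]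
    simp
  · simp [tailVec, hk]
  · rw [tailVec_eq_prod_mul (Nat.le_succ k) h, if_neg (by omega)]
    simp

theorem sum_tailVec_mul_self {N : ℕ} (φ : ℕ → ℝ) {k : ℕ} (hk : k < N) :
    ∑ j ∈ Finset.Icc 1 N, tailVec N φ k j * tailVec N φ k j = 1 := by
  obtain ⟨d, hd⟩ : ∃ d, N = k + 1 + d := ⟨N - (k + 1), by omega⟩
  induction d generalizing k with
  | zero =>
    rw [Finset.sum_eq_single N]
    · simp [tailVec, hd]
    · intro j hj hjN
      rw [Finset.mem_Icc] at hj
      rw [tailVec_of_le (by omega), zero_mul]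
    · simp
      omega
  | succ d ih =>
    have hk' : k + 1 < N := by omega
    have hterm : ∀ j, tailVec N φ k j * tailVec N φ k j =
        (if j = k + 1 then Real.sin (φ (k + 1)) ^ 2 else 0) +
          Real.cos (φ (k + 1)) ^ 2 * (tailVec N φ (k + 1) j * tailVec N φ (k + 1) j) := by
      intro j
      rw [tailVec_eq_single_add hk']
      split_ifs with h
      · rw [tailVec_of_le h.le]
        ring
      · ring
    rw [Finset.sum_congr rfl fun j _ => hterm j, Finset.sum_add_distrib, ← Finset.mul_sum,
      ih hk' (by omega), Finset.sum_ite_eq', if_pos (by simp; omega)]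
    simp

theorem sum_tailVec_mul_realCol {N : ℕ} (φ : ℕ → ℝ) {m k : ℕ} (hmk : m < k) (hk : k < N) :
    ∑ j ∈ Finset.Icc 1 N, tailVec N φ m j * realCol N φ k j = 0 := by
  obtain ⟨i, rfl⟩ : ∃ i, k = i + 1 := ⟨k - 1, by omega⟩
  have hterm : ∀ j, tailVec N φ m j * realCol N φ (i + 1) j =
      (∏ l ∈ Finset.Icc (m + 1) i, Real.cos (φ l)) *
        (Real.sin (φ (i + 1)) * Real.cos (φ (i + 1))) *
        ((if j = i + 1 then 1 else 0) - tailVec N φ (i + 1) j * tailVec N φ (i + 1) j) := by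
    intro j
    rw [realCol, if_neg hk.ne]
    rcases lt_trichotomy j (i + 1) with h | rfl | h
    · rw [if_neg h.ne, if_neg h.ne, tailVec_of_le h.le]
      ring
    · rw [tailVec_eq_prod_mul (Nat.lt_succ_iff.1 hmk) (Nat.lt_succ_self i),
        tailVec_eq_single_add hk, tailVec_of_le le_rfl]
      simp
      ring
    · rw [tailVec_eq_prod_mul (Nat.lt_succ_iff.1 hmk) (by omega : i < j),
        tailVec_eq_single_add hk, if_neg h.ne', if_neg h.ne', if_neg h.ne']
      ring
  rw [Finset.sum_congr rfl fun j _ => hterm j, ← Finset.mul_sum, Finset.sum_sub_distrib,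
    sum_tailVec_mul_self φ hk, Finset.sum_ite_eq', if_pos (by simp; omega)]
  simp

theorem sum_realCol_mul_self {N : ℕ} (φ : ℕ → ℝ) {k : ℕ} (hk : 1 ≤ k) (hkN : k ≤ N) :
    ∑ j ∈ Finset.Icc 1 N, realCol N φ k j * realCol N φ k j = 1 := by
  rcases hkN.eq_or_lt with rfl | h
  · simpa [realCol] using sum_tailVec_mul_self φ (by omega : 0 < k)
  have hterm : ∀ j, realCol N φ k j * realCol N φ k j =
      (if j = k then Real.cos (φ k) ^ 2 else 0) +
        Real.sin (φ k) ^ 2 * (tailVec N φ k j * tailVec N φ k j) := by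
    intro j
    rw [realCol, if_neg h.ne]
    split_ifs with hj
    · rw [tailVec_of_le hj.le]
      ring
    · ring
  rw [Finset.sum_congr rfl fun j _ => hterm j, Finset.sum_add_distrib, ← Finset.mul_sum,
    sum_tailVec_mul_self φ h, Finset.sum_ite_eq', if_pos (by simp; omega)]
  simp

theorem sum_realCol_mul_of_lt {N : ℕ} (φ : ℕ → ℝ) {k k' : ℕ} (hk : 1 ≤ k) (hkk : k < k')
    (hkN : k' ≤ N) :
    ∑ j ∈ Finset.Icc 1 N, realCol N φ k j * realCol N φ k' j = 0 := by
  rcases hkN.eq_or_lt with rfl | h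
  · rw [← sum_tailVec_mul_realCol φ (by omega : 0 < k) hkk]
    refine Finset.sum_congr rfl fun j _ => ?_
    simp [realCol, mul_comm]
  have hterm : ∀ j, realCol N φ k j * realCol N φ k' j =
      -Real.sin (φ k) * (tailVec N φ k j * realCol N φ k' j) := by
    intro j
    by_cases hj : j = k
    · have : realCol N φ k' j = 0 := by
        rw [realCol, if_neg h.ne, if_neg (by omega), tailVec_of_le (by omega)]
        simp
      simp [this]
    · rw [realCol, if_neg (by omega), if_neg hj]
      ring
  rw [Finset.sum_congr rfl fun j _ => hterm j, ← Finset.mul_sum,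
    sum_tailVec_mul_realCol φ hkk h, mul_zero]

theorem realCol_mem_orthogonalGroup (N : ℕ) (φ : ℕ → ℝ) :
    (Matrix.of fun j k : Fin N => realCol N φ ((j : ℕ) + 1) ((k : ℕ) + 1)) ∈
      Matrix.orthogonalGroup (Fin N) ℝ := by
  rw [Matrix.mem_orthogonalGroup_iff]
  ext a b
  have hsum : ∀ f : ℕ → ℝ, ∑ j : Fin N, f ((j : ℕ) + 1) = ∑ j ∈ Finset.Icc 1 N, f j := by
    intro f
    rw [Fin.sum_univ_eq_sum_range (fun j => f (j + 1)) N, Finset.range_eq_Ico,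
      Finset.sum_Ico_add' f 0 N 1]
    rfl
  simp only [Matrix.mul_apply, Matrix.transpose_apply, Matrix.of_apply]
  rw [hsum fun j => realCol N φ ((a : ℕ) + 1) j * realCol N φ ((b : ℕ) + 1) j]
  rcases lt_trichotomy a b with h | rfl | h
  · rw [Matrix.one_apply_ne h.ne]
    exact sum_realCol_mul_of_lt φ (by omega) (by simpa using h) (by omega)
  · rw [Matrix.one_apply_eq]
    exact sum_realCol_mul_self φ (by omega) (by omega)
  · rw [Matrix.one_apply_ne h.ne']
    simp_rw [mul_comm (realCol N φ ((a : ℕ) + 1) _)]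
    exact sum_realCol_mul_of_lt φ (by omega) (by simpa using h) (by omega)

theorem negSum_eq_sum_sub {N : ℕ} (α : ℕ → ℝ) {j : ℕ} (hj : 1 ≤ j) (hjN : j ≤ N) :
    negSum N α j = (∑ l ∈ Finset.Icc 1 N, α l) - α j := by
  have hset : Finset.Icc 1 N = insert j (Finset.Icc 1 (j - 1) ∪ Finset.Icc (j + 1) N) := by
    ext x
    simp only [Finset.mem_insert, Finset.mem_union, Finset.mem_Icc]
    omega
  rw [hset, Finset.sum_insert, Finset.sum_union, negSum]
  · ring
  · rw [Finset.disjoint_left]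
    intro x
    simp only [Finset.mem_Icc]
    omega
  · simp only [Finset.mem_union, Finset.mem_Icc]
    omega

theorem rEntry_eq_phase_mul_realCol {N : ℕ} (hN : 2 ≤ N) (α φ : ℕ → ℝ) {j k : ℕ} (hj : 1 ≤ j)
    (hjN : j ≤ N) (hkN : k ≤ N) :
    rEntry N α φ j k =
      Complex.exp (Complex.I * (α j : ℂ)) * (realCol N φ k j : ℂ) *
        (if k = N - 1 then Complex.exp (-Complex.I * ((∑ l ∈ Finset.Icc 1 N, α l : ℝ) : ℂ))
          else 1) := by
  have hphase : ∀ i, 1 ≤ i → i ≤ N → Complex.exp (-Complex.I * (negSum N α i : ℂ)) =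
      Complex.exp (Complex.I * (α i : ℂ)) *
        Complex.exp (-Complex.I * ((∑ l ∈ Finset.Icc 1 N, α l : ℝ) : ℂ)) := by
    intro i hi hiN
    rw [negSum_eq_sum_sub α hi hiN, ← Complex.exp_add]
    congr 1
    push_cast
    ring
  unfold rEntry
  by_cases hk : k = N
  · subst hk
    rw [if_pos rfl, if_neg (by omega : ¬ k = k - 1), realCol, if_pos rfl, tailVec,
      if_neg (by omega : ¬ j ≤ 0)]
    by_cases hj' : j < k
    · rw [if_pos hj', if_pos hj']
      push_cast
      ring
    · obtain rfl : j = k := by omega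
      simp
  rw [if_neg hk, realCol, if_neg hk]
  by_cases hk1 : k = N - 1
  · rw [if_pos hk1, if_pos hk1]
    by_cases h1 : j < N - 1
    · rw [if_pos h1, if_neg (by omega), tailVec_of_le (by omega)]
      simp
    · rw [if_neg h1]
      by_cases h2 : j = N - 1
      · rw [if_pos h2, if_pos (by omega), tailVec_of_le (by omega), ← h2, hphase j hj hjN,
          hk1, ← h2]
        push_cast
        ring
      · obtain rfl : j = N := by omega
        subst hk1
        rw [if_neg h2, if_neg (by omega : ¬ j = j - 1), hphase j hj hjN, tailVec,
          if_neg (by omega : ¬ j ≤ j - 1), if_neg (lt_irrefl _),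
          Finset.Icc_eq_empty (by omega : ¬ j - 1 + 1 ≤ j - 1)]
        push_cast
        simp
        ring
  · rw [if_neg hk1, if_neg hk1]
    rcases lt_trichotomy j k with h | rfl | h
    · rw [if_pos h, if_neg (by omega), tailVec_of_le h.le]
      simp
    · simp [tailVec_of_le]
    · rw [if_neg (by omega : ¬ j < k), if_neg h.ne', if_neg h.ne', tailVec,
        if_neg (by omega : ¬ j ≤ k)]
      by_cases hj' : j < N
      · rw [if_pos (by omega), if_pos hj']
        push_cast
        ring
      · obtain rfl : j = N := by omega
        rw [if_neg (by omega : ¬ j ≤ j - 1), if_neg hj']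
        push_cast
        ring

theorem diagonal_mem_unitaryGroup {n : Type*} [Fintype n] [DecidableEq n] {d : n → ℂ}
    (hd : ∀ i, ‖d i‖ = 1) : Matrix.diagonal d ∈ Matrix.unitaryGroup n ℂ := by
  rw [Matrix.mem_unitaryGroup_iff, Matrix.star_eq_conjTranspose, Matrix.diagonal_conjTranspose,
    Matrix.diagonal_mul_diagonal, ← Matrix.diagonal_one]
  congr 1
  ext i
  simp [Complex.mul_conj, Complex.normSq_eq_norm_sq, hd]

theorem map_ofReal_mem_unitaryGroup {n : Type*} [Fintype n] [DecidableEq n] {Q : Matrix n n ℝ}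
    (hQ : Q ∈ Matrix.orthogonalGroup n ℝ) :
    Q.map Complex.ofRealHom ∈ Matrix.unitaryGroup n ℂ := by
  rw [Matrix.mem_orthogonalGroup_iff] at hQ
  rw [Matrix.mem_unitaryGroup_iff]
  have hstar : star (Q.map Complex.ofRealHom) = (star Q).map Complex.ofRealHom := by
    ext i j
    simp [Matrix.star_apply]
  rw [hstar, ← Matrix.map_mul, Matrix.star_eq_conjTranspose,
    Matrix.conjTranspose_eq_transpose_of_trivial, hQ]
  simp

/-- For `N ≥ 2` and angles `α_1, …, α_N ∈ [0, 2π)`,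
`φ_1, …, φ_{N-1} ∈ [0, π/2]`, there is an `s ∈ {0, 1}` such that the matrix with columns
`(-1)^s R_{N,1}, R_{N,2}, …, R_{N,N}` belongs to `SU(N)`; equivalently, the determinant of
the matrix with columns `R_{N,1}, …, R_{N,N}` is `1` or `-1`. -/
theorem exists_sign_column_matrix_mem_specialUnitaryGroup
    (N : ℕ) (hN : 2 ≤ N) (α φ : ℕ → ℝ)
    (hα : ∀ j ∈ Finset.Icc 1 N, α j ∈ Set.Ico 0 (2 * Real.pi))
    (hφ : ∀ j ∈ Finset.Icc 1 (N - 1), φ j ∈ Set.Icc 0 (Real.pi / 2)) :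
    (∃ s ∈ ({0, 1} : Set ℕ),
      (Matrix.of fun j k : Fin N =>
          (if (k : ℕ) = 0 then ((-1 : ℂ)) ^ s else 1) *
            rEntry N α φ ((j : ℕ) + 1) ((k : ℕ) + 1)) ∈
        Matrix.specialUnitaryGroup (Fin N) ℂ) ∧
    ((Matrix.of fun j k : Fin N => rEntry N α φ ((j : ℕ) + 1) ((k : ℕ) + 1)).det = 1 ∨
      (Matrix.of fun j k : Fin N => rEntry N α φ ((j : ℕ) + 1) ((k : ℕ) + 1)).det = -1) := by
  set M : Matrix (Fin N) (Fin N) ℂ :=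
    Matrix.of fun j k : Fin N => rEntry N α φ ((j : ℕ) + 1) ((k : ℕ) + 1) with hM
  set S : ℂ := ((∑ l ∈ Finset.Icc 1 N, α l : ℝ) : ℂ) with hS
  set Q : Matrix (Fin N) (Fin N) ℝ :=
    (Matrix.of fun j k : Fin N => realCol N φ ((j : ℕ) + 1) ((k : ℕ) + 1))ᵀ with hQdef
  set d : Fin N → ℂ := fun j => Complex.exp (Complex.I * (α ((j : ℕ) + 1) : ℂ)) with hd
  set e : Fin N → ℂ := fun k => if (k : ℕ) + 1 = N - 1 then Complex.exp (-Complex.I * S) else 1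
    with he
  have hQ : Q ∈ Matrix.orthogonalGroup (Fin N) ℝ := by
    have h := realCol_mem_orthogonalGroup N φ
    rw [Matrix.mem_orthogonalGroup_iff'] at h
    rw [Matrix.mem_orthogonalGroup_iff]
    simpa [hQdef] using h
  have hfac : M = Matrix.diagonal d * Q.map Complex.ofRealHom * Matrix.diagonal e := by
    ext j k
    rw [Matrix.mul_diagonal, Matrix.diagonal_mul]
    exact rEntry_eq_phase_mul_realCol hN α φ (by omega) (by omega) (by omega)
  have hd1 : ∀ i, ‖d i‖ = 1 := fun i => by
    simp only [hd, mul_comm Complex.I]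
    exact Complex.norm_exp_ofReal_mul_I _
  have he1 : ∀ i, ‖e i‖ = 1 := fun i => by
    simp only [he]
    split_ifs
    · rw [hS, neg_mul, mul_comm, ← neg_mul, ← Complex.ofReal_neg]
      exact Complex.norm_exp_ofReal_mul_I _
    · simp
  have hMU : M ∈ Matrix.unitaryGroup (Fin N) ℂ := by
    rw [hfac]
    exact mul_mem (mul_mem (diagonal_mem_unitaryGroup hd1) (map_ofReal_mem_unitaryGroup hQ))
      (diagonal_mem_unitaryGroup he1)
  have hprodd : ∏ i, d i = Complex.exp (Complex.I * S) := by
    rw [← Complex.exp_sum, ← Finset.mul_sum,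
      Fin.sum_univ_eq_sum_range (fun j => (α (j + 1) : ℂ)) N, Finset.range_eq_Ico,
      Finset.sum_Ico_add' (fun j => (α j : ℂ)) 0 N 1, hS, Complex.ofReal_sum]
    rfl
  have hprode : ∏ i, e i = Complex.exp (-Complex.I * S) := by
    rw [Finset.prod_eq_single (⟨N - 2, by omega⟩ : Fin N)]
    · simp only [he]
      rw [if_pos (by omega)]
    · intro b _ hb
      simp only [he]
      refine if_neg fun h => hb (Fin.ext ?_)
      simp only
      omega
    · simp
  have hdetM : M.det = (Q.det : ℂ) := by
    have hQdet : (Q.map Complex.ofRealHom).det = (Q.det : ℂ) :=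
      (RingHom.map_det Complex.ofRealHom Q).symm
    rw [hfac, Matrix.det_mul, Matrix.det_mul, Matrix.det_diagonal, Matrix.det_diagonal, hprodd,
      hprode, hQdet, mul_right_comm, ← Complex.exp_add]
    simp
  have hdet : M.det = 1 ∨ M.det = -1 := by
    have h : Q.det * Q.det = 1 := by
      have := congrArg Matrix.det ((Matrix.mem_orthogonalGroup_iff _ _).1 hQ)
      simpa using this
    rw [hdetM]
    rcases mul_self_eq_one_iff.1 h with h | h <;> simp [h]
  refine ⟨?_, hdet⟩
  rcases hdet with h | h
  · refine ⟨0, by simp, ?_⟩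
    simpa [Matrix.mem_specialUnitaryGroup_iff] using And.intro hMU h
  · refine ⟨1, by simp, ?_⟩
    set t : Fin N → ℂ := fun k => if (k : ℕ) = 0 then (-1) ^ 1 else 1 with ht
    have hfac' : (Matrix.of fun j k : Fin N =>
        (if (k : ℕ) = 0 then ((-1 : ℂ)) ^ 1 else 1) *
          rEntry N α φ ((j : ℕ) + 1) ((k : ℕ) + 1)) = M * Matrix.diagonal t := by
      ext j k
      rw [Matrix.mul_diagonal, mul_comm]
      rfl
    have ht1 : ∀ i, ‖t i‖ = 1 := fun i => by
      simp only [ht]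
      split_ifs <;> simp
    have hprodt : ∏ i, t i = -1 := by
      rw [Finset.prod_eq_single (⟨0, by omega⟩ : Fin N)]
      · simp [ht]
      · intro b _ hb
        exact if_neg fun h => hb (Fin.ext h)
      · simp
    rw [hfac', Matrix.mem_specialUnitaryGroup_iff, Matrix.det_mul, Matrix.det_diagonal, h, hprodt]
    exact ⟨mul_mem hMU (diagonal_mem_unitaryGroup ht1), by norm_num⟩
end

section
/- For $n \geq 3$, real numbers $m > 0$ and $\mu$, the one-flavor partition function of one-dimensional lattice QCD with gauge group $U(1)$ equals the product of the recursion values: $Z(m, \mu, U(1), n) = \int_{U(1)} \det D(1, \dots, 1, u) \, dh(u) = \prod_{j=1}^{n} \tilde m_j$, where $\tilde m_1 = m$, $\tilde m_j = m + \frac{1}{4\tilde m_{j-1}}$ for $2 \leq j \leq n-1$, $\tilde m_n = m + \frac{1}{4\tilde m_{n-1}} + \sum_{j=1}^{n-1} \frac{(-1)^{j+1} 2^{-2j}}{\tilde m_j \prod_{k=1}^{j-1} \tilde m_k^2}$, and $D(1,\dots,1,u)$ is the $n \times n$ complex matrix with diagonal entries $m$, superdiagonal entries $\frac{e^\mu}{2}$,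 subdiagonal entries $-\frac{e^{-\mu}}{2}$, entry $\frac{e^{-\mu}}{2} \bar u$ in position $(1,n)$, entry $-\frac{e^{\mu}}{2} u$ in position $(n,1)$, and zeros elsewhere. -/
open Complex Matrix Finset MeasureTheory

noncomputable instance : MeasurableSpace Circle := borel Circle
instance : BorelSpace Circle := ⟨rfl⟩

/-- The recursion `m̃₁ = m`, `m̃_{j+1} = m + 1/(4 m̃_j)`; here `mtilde m (j-1) = m̃_j`
(0-based shift). -/
noncomputable def mtilde (m : ℝ) : ℕ → ℝ
  | 0 => m
  | j + 1 => m + 1 / (4 * mtilde m j)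

/-- The last recursion value
`m̃_n = m + 1/(4 m̃_{n-1}) + ∑_{j=1}^{n-1} (-1)^{j+1} 2^{-2j} / (m̃_j ∏_{k=1}^{j-1} m̃_k²)`. -/
noncomputable def mtildeLast (m : ℝ) (n : ℕ) : ℝ :=
  m + 1 / (4 * mtilde m (n - 2)) +
    ∑ j ∈ Finset.Icc 1 (n - 1),
      ((-1 : ℝ) ^ (j + 1) * ((2 : ℝ) ^ (2 * j))⁻¹) /
        (mtilde m (j - 1) * ∏ k ∈ Finset.Icc 1 (j - 1), mtilde m (k - 1) ^ 2)

/-- The `n × n` gauge-fixed Dirac matrix `D(1, …, 1, u)` for gauge group `U(1)`: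
diagonal entries `m`, superdiagonal entries `e^μ/2`, subdiagonal entries `-e^{-μ}/2`,
entry `(e^{-μ}/2) ū` in position `(1, n)`, entry `-(e^μ/2) u` in position `(n, 1)`,
zeros elsewhere.  (Indices of `Fin n` are 0-based.) -/
noncomputable def diracU1 (n : ℕ) (m μ : ℝ) (u : ℂ) : Matrix (Fin n) (Fin n) ℂ :=
  Matrix.of fun j k =>
    if (j : ℕ) = (k : ℕ) then (m : ℂ)
    else if (k : ℕ) = (j : ℕ) + 1 then ((Real.exp μ / 2 : ℝ) : ℂ)
    else if (j : ℕ) = (k : ℕ) + 1 then ((-(Real.exp (-μ) / 2) : ℝ) : ℂ)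
    else if (j : ℕ) = 0 ∧ (k : ℕ) = n - 1 then ((Real.exp (-μ) / 2 : ℝ) : ℂ) * (starRingEnd ℂ) u
    else if (j : ℕ) = n - 1 ∧ (k : ℕ) = 0 then -(((Real.exp μ / 2 : ℝ) : ℂ) * u)
    else 0

/-- The tridiagonal Toeplitz matrix with diagonal `a`, superdiagonal `b` and subdiagonal `c`. -/
def triToeplitz {R : Type*} [Zero R] (a b c : R) (n : ℕ) : Matrix (Fin n) (Fin n) R :=
  Matrix.of fun j k =>
    if (j : ℕ) = (k : ℕ) then a
    else if (k : ℕ) = (j : ℕ) + 1 then b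
    else if (j : ℕ) = (k : ℕ) + 1 then c
    else 0

theorem triToeplitz_submatrix_succ {R : Type*} [Zero R] (a b c : R) (n : ℕ) :
    (triToeplitz a b c (n + 1)).submatrix Fin.succ Fin.succ = triToeplitz a b c n := by
  ext j k
  simp [triToeplitz]

theorem det_triToeplitz_add_two {R : Type*} [CommRing R] (a b c : R) (n : ℕ) :
    (triToeplitz a b c (n + 2)).det =
      a * (triToeplitz a b c (n + 1)).det - b * c * (triToeplitz a b c n).det := by
  rw [det_succ_row_zero, Fin.sum_univ_succ, Fin.sum_univ_succ, Finset.sum_eq_zero, add_zero]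
  · have h0 : (triToeplitz a b c (n + 2)).submatrix Fin.succ (Fin.succAbove 0) =
        triToeplitz a b c (n + 1) := by
      rw [Fin.succAbove_zero, triToeplitz_submatrix_succ]
    have h1 : ((triToeplitz a b c (n + 2)).submatrix Fin.succ
        (Fin.succAbove (Fin.succ 0))).det = c * (triToeplitz a b c n).det := by
      rw [det_succ_column_zero, Fin.sum_univ_succ, Finset.sum_eq_zero, add_zero]
      · have h2 : ((triToeplitz a b c (n + 2)).submatrix Fin.succ
            (Fin.succAbove (Fin.succ 0))).submatrix (Fin.succAbove 0) Fin.succ =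
            triToeplitz a b c n := by
          ext j k
          simp [triToeplitz, Fin.succAbove, Fin.lt_def]
        rw [h2]
        simp [triToeplitz, Fin.succAbove]
      · intro i _
        simp [triToeplitz, Fin.succAbove]
    rw [h0, h1]
    simp [triToeplitz]
    ring
  · intro i _
    simp [triToeplitz]

theorem det_updateRow_updateRow_add_smul {R ι : Type*} [CommRing R] [Fintype ι] [DecidableEq ι]
    (A : Matrix ι ι R) {i j : ι} (hij : i ≠ j) (x y : R) (v w : ι → R) :
    ((A.updateRow i (A i + x • v)).updateRow j (A j + y • w)).det =
      A.det + x * (A.updateRow i v).det + y * (A.updateRow j w).det +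
        x * y * ((A.updateRow i v).updateRow j w).det := by
  have hj (z : ι → R) : (A.updateRow i z).updateRow j (A j) = A.updateRow i z := by
    conv_rhs => rw [← updateRow_eq_self (A.updateRow i z) j]
    rw [updateRow_ne hij.symm]
  have hi : (A.updateRow j w).updateRow i (A i) = A.updateRow j w := by
    conv_rhs => rw [← updateRow_eq_self (A.updateRow j w) i]
    rw [updateRow_ne hij]
  rw [det_updateRow_add, det_updateRow_smul, hj, det_updateRow_add, det_updateRow_smul,
    updateRow_eq_self, updateRow_comm _ hij, det_updateRow_add, det_updateRow_smul, hi,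
    updateRow_comm _ hij.symm]
  ring

theorem det_triToeplitz_updateRow_corners {R : Type*} [CommRing R] (a b c : R) (n : ℕ) :
    (((triToeplitz a b c (n + 2)).updateRow 0 (Pi.single (Fin.last (n + 1)) 1)).updateRow
      (Fin.last (n + 1)) (Pi.single 0 1)).det = -(triToeplitz a b c n).det := by
  rw [det_succ_row_zero, Finset.sum_eq_single (Fin.last (n + 1))]
  · rw [det_succ_row _ (Fin.last n), Finset.sum_eq_single 0]
    · have h2 : ((((triToeplitz a b c (n + 2)).updateRow 0
          (Pi.single (Fin.last (n + 1)) 1)).updateRow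
          (Fin.last (n + 1)) (Pi.single 0 1)).submatrix Fin.succ
          (Fin.succAbove (Fin.last (n + 1)))).submatrix
          (Fin.succAbove (Fin.last n)) (Fin.succAbove 0) = triToeplitz a b c n := by
        ext j k
        have hj : (j.castSucc.succ : Fin (n + 2)) ≠ Fin.last (n + 1) := by
          simp [Fin.ext_iff, j.2.ne]
        simp [triToeplitz, updateRow_apply, hj]
      rw [h2]
      have hl : (0 : Fin (n + 2)) ≠ Fin.last (n + 1) := by simp [Fin.ext_iff]
      simp [updateRow_apply, hl, pow_succ, ← mul_assoc, ← mul_pow]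
    · intro k _ hk
      simp [updateRow_apply, hk]
    · simp
  · intro k _ hk
    have hl : (0 : Fin (n + 2)) ≠ Fin.last (n + 1) := by simp [Fin.ext_iff]
    simp [updateRow_apply, hl, hk]
  · simp

theorem diracU1_eq_updateRow (n : ℕ) (m μ : ℝ) (u : ℂ) :
    diracU1 (n + 3) m μ u =
      ((triToeplitz (m : ℂ) ((Real.exp μ / 2 : ℝ) : ℂ)
          ((-(Real.exp (-μ) / 2) : ℝ) : ℂ) (n + 3)).updateRow 0
        (triToeplitz (m : ℂ) ((Real.exp μ / 2 : ℝ) : ℂ)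
          ((-(Real.exp (-μ) / 2) : ℝ) : ℂ) (n + 3) 0 +
          (((Real.exp (-μ) / 2 : ℝ) : ℂ) * (starRingEnd ℂ) u) •
            Pi.single (Fin.last (n + 2)) 1)).updateRow (Fin.last (n + 2))
        (triToeplitz (m : ℂ) ((Real.exp μ / 2 : ℝ) : ℂ)
          ((-(Real.exp (-μ) / 2) : ℝ) : ℂ) (n + 3) (Fin.last (n + 2)) +
          (-(((Real.exp μ / 2 : ℝ) : ℂ) * u)) • Pi.single 0 1) := by
  ext j k
  simp only [diracU1, triToeplitz, updateRow_apply, of_apply, Pi.add_apply, Pi.smul_apply,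
    Pi.single_apply, Fin.ext_iff, Fin.val_last, Fin.val_zero, smul_eq_mul, mul_ite, mul_one,
    mul_zero]
  split_ifs <;> first | contradiction | omega | simp

theorem integral_circle_coe (h : Measure Circle) [h.IsMulLeftInvariant] :
    ∫ u : Circle, (u : ℂ) ∂h = 0 := by
  have key := integral_mul_left_eq_self (μ := h) (fun u : Circle => (u : ℂ)) (Circle.exp Real.pi)
  simp only [Circle.coe_mul, Circle.coe_exp, Complex.exp_pi_mul_I, neg_one_mul,
    integral_neg] at key
  exact self_eq_neg.mp key.symm

theorem mtilde_pos {m : ℝ} (hm : 0 < m) : ∀ j, 0 < mtilde m j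
  | 0 => hm
  | j + 1 => by
    have := mtilde_pos hm j
    rw [mtilde]
    positivity

theorem prod_range_mtilde_add_two {m : ℝ} (hm : 0 < m) (n : ℕ) :
    ∏ j ∈ Finset.range (n + 2), mtilde m j =
      m * ∏ j ∈ Finset.range (n + 1), mtilde m j + 1 / 4 * ∏ j ∈ Finset.range n, mtilde m j := by
  have := (mtilde_pos hm n).ne'
  rw [Finset.prod_range_succ _ (n + 1), Finset.prod_range_succ _ n, mtilde]
  field_simp

theorem det_triToeplitz_eq_prod_mtilde {m : ℝ} (hm : 0 < m) {b c : ℂ} (hbc : b * c = -(1 / 4)) :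
    ∀ n, (triToeplitz (m : ℂ) b c n).det = ((∏ j ∈ Finset.range n, mtilde m j : ℝ) : ℂ)
  | 0 => by simp
  | 1 => by simp [triToeplitz, mtilde]
  | n + 2 => by
    rw [det_triToeplitz_add_two, hbc, det_triToeplitz_eq_prod_mtilde hm hbc n,
      det_triToeplitz_eq_prod_mtilde hm hbc (n + 1), prod_range_mtilde_add_two hm]
    push_cast
    ring

theorem prod_range_mtilde_wronskian {m : ℝ} (hm : 0 < m) (n : ℕ) :
    (∏ j ∈ Finset.range (n + 1), mtilde m j) ^ 2 -
      (∏ j ∈ Finset.range n, mtilde m j) * ∏ j ∈ Finset.range (n + 2), mtilde m j =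
      (-1 / 4) ^ (n + 1) := by
  induction n with
  | zero =>
    rw [prod_range_mtilde_add_two hm]
    simp [mtilde]
    ring
  | succ n ih =>
    rw [prod_range_mtilde_add_two hm (n + 1), pow_succ (-1 / 4 : ℝ), ← ih]
    linear_combination (∏ j ∈ Finset.range (n + 2), mtilde m j) * prod_range_mtilde_add_two hm n

theorem prod_Icc_one_pred {M : Type*} [CommMonoid M] (f : ℕ → M) (n : ℕ) :
    ∏ j ∈ Finset.Icc 1 n, f (j - 1) = ∏ j ∈ Finset.range n, f j := by
  rw [← Finset.Ico_add_one_right_eq_Icc, Finset.prod_Ico_eq_prod_range]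
  simp

theorem prod_mul_sum_mtilde {m : ℝ} (hm : 0 < m) (n : ℕ) :
    (∏ j ∈ Finset.range (n + 1), mtilde m j) *
      ∑ j ∈ Finset.Icc 1 (n + 1), ((-1 : ℝ) ^ (j + 1) * ((2 : ℝ) ^ (2 * j))⁻¹) /
        (mtilde m (j - 1) * ∏ k ∈ Finset.Icc 1 (j - 1), mtilde m (k - 1) ^ 2) =
      1 / 4 * ∏ j ∈ Finset.range n, mtilde m j := by
  induction n with
  | zero =>
    have := hm.ne'
    simp [mtilde]
    field_simp
    norm_num
  | succ n ih =>
    have hW := prod_range_mtilde_wronskian hm n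
    have hP : (∏ j ∈ Finset.range n, mtilde m j) ≠ 0 :=
      Finset.prod_ne_zero_iff.mpr fun j _ => (mtilde_pos hm j).ne'
    have h0 := (mtilde_pos hm n).ne'
    have h1 := (mtilde_pos hm (n + 1)).ne'
    rw [Finset.sum_Icc_succ_top (by omega), mul_add, prod_Icc_one_pred (fun k => mtilde m k ^ 2),
      Finset.prod_pow, Finset.prod_range_succ _ (n + 1), mul_right_comm, ih]
    simp only [Finset.prod_range_succ, Nat.add_sub_cancel] at hW ⊢
    generalize ∏ j ∈ Finset.range n, mtilde m j = P at *
    have hs : (-1 : ℝ) ^ (n + 1 + 1 + 1) * ((2 : ℝ) ^ (2 * (n + 1 + 1)))⁻¹ =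
        1 / 4 * (-1 / 4) ^ (n + 1) := by
      rw [pow_mul, div_pow]
      norm_num [pow_succ]
      ring
    rw [hs, ← hW]
    field_simp
    ring

/-- For `n ≥ 3`, `m > 0` and `μ ∈ ℝ`, the one-flavor partition function of
one-dimensional lattice QCD with gauge group `U(1)` equals the product of the recursion
values: `Z(m, μ, U(1), n) = ∫_{U(1)} det D(1, …, 1, u) dh(u) = ∏_{j=1}^n m̃_j`, where `h` is
the normalized Haar probability measure on the circle group. -/
theorem partition_function_U1_eq_prod_mtilde (n : ℕ) (hn : 3 ≤ n) (m μ : ℝ) (hm : 0 < m)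
    (h : Measure Circle) [IsProbabilityMeasure h] [h.IsMulLeftInvariant] :
    ∫ u : Circle, (diracU1 n m μ (u : ℂ)).det ∂h =
      (((∏ j ∈ Finset.Icc 1 (n - 1), mtilde m (j - 1)) * mtildeLast m n : ℝ) : ℂ) := by
  obtain ⟨n, rfl⟩ : ∃ k, n = k + 3 := ⟨n - 3, by omega⟩
  set b : ℂ := ((Real.exp μ / 2 : ℝ) : ℂ) with hb
  set c : ℂ := ((-(Real.exp (-μ) / 2) : ℝ) : ℂ) with hc
  have hbc : b * c = -(1 / 4) := by
    rw [hb, hc, ← Complex.ofReal_mul]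
    have : Real.exp μ / 2 * -(Real.exp (-μ) / 2) = -(1 / 4) := by
      rw [Real.exp_neg]
      have := (Real.exp_pos μ).ne'
      field_simp
      norm_num
    rw [this]
    norm_num
  have hc' : ((Real.exp (-μ) / 2 : ℝ) : ℂ) = -c := by simp [hc]
  have hl : (0 : Fin (n + 3)) ≠ Fin.last (n + 2) := by simp [Fin.ext_iff]
  set T := triToeplitz (m : ℂ) b c (n + 3) with hT
  obtain ⟨B, hB⟩ : ∃ B, B = (T.updateRow 0 (Pi.single (Fin.last (n + 2)) 1)).det := ⟨_, rfl⟩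
  obtain ⟨C, hC⟩ : ∃ C, C = (T.updateRow (Fin.last (n + 2)) (Pi.single 0 1)).det := ⟨_, rfl⟩
  have hdet (u : Circle) : (diracU1 (n + 3) m μ (u : ℂ)).det =
      (T.det + 1 / 4 * (triToeplitz (m : ℂ) b c (n + 1)).det) +
        (-c * B) * (starRingEnd ℂ) (u : ℂ) + (-b * C) * (u : ℂ) := by
    have hu : (u : ℂ) * (starRingEnd ℂ) (u : ℂ) = 1 := by simp [Complex.mul_conj]
    rw [diracU1_eq_updateRow, ← hb, ← hc, ← hT, det_updateRow_updateRow_add_smul _ hl,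
      det_triToeplitz_updateRow_corners, ← hB, ← hC, hc']
    linear_combination (-(b * c) * (triToeplitz (m : ℂ) b c (n + 1)).det) * hu -
      (triToeplitz (m : ℂ) b c (n + 1)).det * hbc
  have hcont : Continuous fun u : Circle => (u : ℂ) := by fun_prop
  have hi : Integrable (fun u : Circle => (u : ℂ)) h :=
    hcont.integrable_of_hasCompactSupport (HasCompactSupport.of_compactSpace _)
  have hi' : Integrable (fun u : Circle => (starRingEnd ℂ) (u : ℂ)) h :=
    (Complex.continuous_conj.comp hcont).integrable_of_hasCompactSupport
      (HasCompactSupport.of_compactSpace _)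
  have hint (x y z : ℂ) :
      ∫ u : Circle, (x + y * (starRingEnd ℂ) (u : ℂ) + z * (u : ℂ)) ∂h = x := by
    have hxy : Integrable (fun u : Circle => x + y * (starRingEnd ℂ) (u : ℂ)) h :=
      (integrable_const x).add (hi'.const_mul y)
    rw [integral_add hxy (hi.const_mul z), integral_add (integrable_const x) (hi'.const_mul y),
      integral_const_mul, integral_const_mul, integral_conj, integral_circle_coe]
    simp
  rw [integral_congr_ae (Filter.Eventually.of_forall hdet), hint, hT,
    det_triToeplitz_eq_prod_mtilde hm hbc, det_triToeplitz_eq_prod_mtilde hm hbc]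
  have hfin : (∏ j ∈ Finset.Icc 1 (n + 3 - 1), mtilde m (j - 1)) * mtildeLast m (n + 3) =
      (∏ j ∈ Finset.range (n + 3), mtilde m j) +
        1 / 4 * ∏ j ∈ Finset.range (n + 1), mtilde m j := by
    rw [prod_Icc_one_pred (mtilde m), mtildeLast, mul_add]
    congr 1
    · rw [Finset.prod_range_succ _ (n + 2)]
      rfl
    · exact prod_mul_sum_mtilde hm (n + 1)
  rw [hfin]
  simp
end
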